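/- Let q be an odd prime power, h an even integer with h ≥ 4 and (q−1)/h = 2τ+1 for some integer τ ≥ 1, set n = (h/2 + 2)(q^2−1)/(2h), and let k be an integer with 1 ≤ k and 2hk ≤ (h+2)(q−1). Then there exist pairwise distinct elements a_1,…,a_n of F_{q^2} and nonzero elements v_1,…,v_n of F_{q^2} such that Σ_{l=1}^n v_l^{q+1} a_l^{q·i+j} = 0 for all integers 0 ≤ i, j ≤ k−1 (with the convention 0^0 = 1); that is, the generalized Reed–Solomon code GRS_k(a,v) is a Hermitian self-orthogonal [n, k, n−k+1] MDS code over F_{q^2}, which by the Hermitian construction yields an [[n, n−2k, k+1]]_q quantum MDS code. -/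

import Mathlib

open Finset

/-- A weighted power sum over distinct nodes, with the weights of the Lagrange divided difference. -/
theorem sum_pow_div_prod_sub_eq_zero {K : Type*} [Field K] {ι : Type*} [Fintype ι] [DecidableEq ι]
    {x : ι → K} (hx : Function.Injective x) {p : ℕ} (hp : p + 1 < Fintype.card ι) :
    ∑ c, x c ^ p / ∏ d ∈ univ.erase c, (x c - x d) = 0 := by
  have hdeg : ((Polynomial.X : Polynomial K) ^ p).degree < #(univ : Finset ι) := by
    rw [Polynomial.degree_X_pow, card_univ]
    exact_mod_cast (by omega : p < Fintype.card ι)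
  have h := Lagrange.coeff_eq_sum (hx.injOn (s := ((univ : Finset ι) : Set ι))) hdeg
  rw [Polynomial.coeff_X_pow, card_univ, if_neg (by omega)] at h
  simpa using h.symm

theorem FiniteField.exists_ringHom_eq_pow {q : ℕ} (hq : IsPrimePow q)
    (F : Type*) [Field F] [Fintype F] (hF : Fintype.card F = q ^ 2) :
    ∃ φ : F →+* F, ∀ x, φ x = x ^ q := by
  obtain ⟨p, e, hp, he, rfl⟩ := hq
  have hp' := hp.nat_prime
  have := Fact.mk hp'
  obtain ⟨r, hr⟩ := CharP.exists F
  have := hr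
  obtain ⟨n, hrp, hn⟩ := FiniteField.card F r
  have hpr : r = p := by
    have : r ∣ (p ^ e) ^ 2 := by
      rw [← hF, hn]; exact dvd_pow_self r n.ne_zero
    exact (Nat.prime_dvd_prime_iff_eq hrp hp').1
      (hrp.dvd_of_dvd_pow (hrp.dvd_of_dvd_pow this))
  subst hpr
  have : ExpChar F r := ExpChar.prime hrp
  exact ⟨iterateFrobenius F r e, fun x => iterateFrobenius_def r e x⟩

theorem FiniteField.exists_orderOf_eq {q : ℕ}
    (F : Type*) [Field F] [Fintype F] (hF : Fintype.card F = q ^ 2) :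
    ∃ θ : F, orderOf θ = q ^ 2 - 1 ∧ ∀ x : F, x ≠ 0 → ∃ n : ℕ, θ ^ n = x := by
  obtain ⟨g, hg⟩ := IsCyclic.exists_generator (α := Fˣ)
  refine ⟨g, ?_, fun x hx => ?_⟩
  · rw [orderOf_units, orderOf_eq_card_of_forall_mem_zpowers hg, Nat.card_units,
      Nat.card_eq_fintype_card, hF]
  · obtain ⟨n, hn⟩ := (mem_powers_iff_mem_zpowers (x := g)).2 (hg (Units.mk0 x hx))
    exact ⟨n, by simpa using congrArg Units.val hn⟩

/-- Elements fixed by `x ↦ x ^ q` are norms from the field with `q ^ 2` elements. -/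
theorem FiniteField.exists_pow_succ_eq {q : ℕ} (hq : 1 < q)
    (F : Type*) [Field F] [Fintype F] (hF : Fintype.card F = q ^ 2)
    {x : F} (hx : x ≠ 0) (hxq : x ^ q = x) : ∃ z : F, z ≠ 0 ∧ z ^ (q + 1) = x := by
  obtain ⟨θ, hθ, hgen⟩ := FiniteField.exists_orderOf_eq F hF
  obtain ⟨e, rfl⟩ := hgen x hx
  obtain ⟨r, rfl⟩ : ∃ r, q = r + 1 := ⟨q - 1, by omega⟩
  have h1 : θ ^ (e * r) = 1 := by
    rw [pow_mul]
    refine mul_right_cancel₀ hx ?_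
    rw [← pow_succ, hxq, one_mul]
  have h2 := orderOf_dvd_of_pow_eq_one h1
  rw [hθ, show (r + 1) ^ 2 - 1 = (r + 1 + 1) * r by
    rw [show (r + 1) ^ 2 = (r + 1 + 1) * r + 1 by ring]; rfl] at h2
  obtain ⟨f, rfl⟩ := Nat.dvd_of_mul_dvd_mul_right (by omega : 0 < r) h2
  have hθ0 : θ ≠ 0 := by
    rintro rfl
    have : (0 : F) ^ ((r + 1 + 1) * f) ≠ 0 := hx
    rcases Nat.eq_zero_or_pos f with rfl | hf
    · have h3 : orderOf (0 : F) = 0 := orderOf_zero F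
      rw [h3] at hθ
      have : 1 < (r + 1) ^ 2 := Nat.one_lt_pow (by norm_num) hq
      omega
    · exact this (zero_pow (by positivity))
  exact ⟨θ ^ f, pow_ne_zero _ hθ0, by rw [← pow_mul, mul_comm]⟩

/-- The exponents surviving summation over the subgroup of order `(2τ+1)(m(2τ+1)+1)`. -/
theorem exists_eq_mul_of_dvd_exponent {m τ q s i j : ℕ} (hτ : 1 ≤ τ) (hm : 2 ≤ m)
    (hs : s = 2 * τ + 1) (hq : q = 2 * (m * s) + 1)
    (hi : i < (m + 1) * s) (hj : j < (m + 1) * s)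
    (hdvd : s * (m * s + 1) ∣ q * i + j + (q + 1) * (τ + 1)) :
    ∃ p, p ≤ m ∧ i = j ∧ i + (τ + 1) = s * (p + 1) := by
  have h1 : (s : ℤ) ∣ i + j + 1 := by
    obtain ⟨c, hc⟩ := (Dvd.intro _ rfl).trans hdvd
    refine ⟨c - 2 * m * i - 2 * m * (τ + 1) - 1, ?_⟩
    have hc' : ((q : ℤ) * i + j + (q + 1) * (τ + 1)) = s * c := by exact_mod_cast hc
    have hq' : (q : ℤ) = 2 * (m * s) + 1 := by exact_mod_cast hq
    have hs' : (s : ℤ) = 2 * τ + 1 := by exact_mod_cast hs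
    rw [hq'] at hc'
    linear_combination hc' + hs'
  have h2 : ((m * s + 1 : ℕ) : ℤ) ∣ j - i := by
    obtain ⟨c, hc⟩ := (Dvd.intro_left _ rfl).trans hdvd
    refine ⟨c - 2 * i - 2 * (τ + 1), ?_⟩
    have hc' : ((q : ℤ) * i + j + (q + 1) * (τ + 1)) = (m * s + 1) * c := by exact_mod_cast hc
    have hq' : (q : ℤ) = 2 * (m * s) + 1 := by exact_mod_cast hq
    rw [hq'] at hc'
    push_cast
    linear_combination hc'
  have hms : 2 * s ≤ m * s := Nat.mul_le_mul_right s hm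
  have hexp : (m + 1) * s = m * s + s := by ring
  rw [hexp] at hi hj
  obtain ⟨c, hc⟩ := h2
  push_cast at hc
  have hc1 : c < 2 := by
    by_contra hcon
    have : ((m : ℤ) * s + 1) * 2 ≤ (m * s + 1) * c :=
      mul_le_mul_of_nonneg_left (by omega) (by positivity)
    zify at hi hj hms
    linarith
  have hc2 : -2 < c := by
    by_contra hcon
    have : ((m : ℤ) * s + 1) * c ≤ (m * s + 1) * (-2) :=
      mul_le_mul_of_nonneg_left (by omega) (by positivity)
    zify at hi hj hms
    linarith
  have hodd : IsCoprime (s : ℤ) 2 := ⟨1, -τ, by rw [hs]; push_cast; ring⟩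
  have key : ∀ a b : ℕ, (s : ℤ) ∣ a + b + 1 → (b : ℤ) = a + (m * s + 1) → b < m * s + s →
      False := by
    intro a b hab hba hb
    have h3 : (s : ℤ) ∣ 2 * (a + 1) := by
      have := dvd_sub hab (Dvd.intro_left (m : ℤ) rfl)
      rwa [hba, show (a : ℤ) + (a + (m * s + 1)) + 1 - m * s = 2 * (a + 1) by ring] at this
    have h4 : s ∣ a + 1 := by exact_mod_cast hodd.dvd_of_dvd_mul_left h3
    have h5 := Nat.le_of_dvd (by omega) h4
    zify at hb h5
    linarith
  have h01 : c = -1 ∨ c = 0 ∨ c = 1 := by omega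
  rcases h01 with rfl | rfl | rfl
  · exact (key j i (by rwa [add_comm (j : ℤ)]) (by linarith) hi).elim
  · have hij : i = j := by omega
    subst hij
    have h3 : (s : ℤ) ∣ 2 * (i + (τ + 1)) := by
      have := dvd_add h1 (dvd_refl (s : ℤ))
      have hs' : (s : ℤ) = 2 * τ + 1 := by exact_mod_cast hs
      rwa [show (i : ℤ) + i + 1 + s = 2 * (i + (τ + 1)) by rw [hs']; ring] at this
    have h4 : s ∣ i + (τ + 1) := by exact_mod_cast hodd.dvd_of_dvd_mul_left h3
    obtain ⟨p, hp⟩ := h4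
    obtain ⟨p, rfl⟩ : ∃ r, p = r + 1 :=
      ⟨p - 1, by rcases p with _ | p <;> simp_all⟩
    refine ⟨p, ?_, rfl, hp⟩
    have : s * (p + 1) < s * (m + 2) := by rw [← hp, mul_add, mul_comm s m]; omega
    have := lt_of_mul_lt_mul_left this (Nat.zero_le s)
    omega
  · exact (key i j h1 (by linarith) hj).elim

theorem thm_qminus_corollary_half_plus_two
    (q h τ n : ℕ) (hq : IsPrimePow q) (hqo : Odd q)
    (hh : 4 ≤ h) (hhe : Even h) (hτ : 1 ≤ τ)
    (hdiv : q - 1 = h * (2 * τ + 1))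
    (hn : 4 * h * n = (h + 4) * (q ^ 2 - 1))  -- i.e. n = (h/2+2)(q²-1)/(2h)
    (k : ℕ) (hk1 : 1 ≤ k)
    (hk : 2 * h * k ≤ (h + 2) * (q - 1))  -- i.e. k ≤ (h+2)(q-1)/(2h)
    (F : Type*) [Field F] [Fintype F] (hF : Fintype.card F = q ^ 2) :
    ∃ a v : Fin n → F, Function.Injective a ∧ (∀ l, v l ≠ 0) ∧
      ∀ i j : ℕ, i < k → j < k →
        ∑ l, v l ^ (q + 1) * a l ^ (q * i + j) = 0 := by
  obtain ⟨m, rfl⟩ := hhe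
  obtain ⟨s, hs⟩ : ∃ s, s = 2 * τ + 1 := ⟨_, rfl⟩
  have hm : 2 ≤ m := by omega
  have hqs : q = 2 * (m * s) + 1 := by
    have h1 : (m + m) * (2 * τ + 1) = 2 * (m * s) := by rw [hs]; ring
    have := hq.one_lt
    omega
  obtain ⟨N, hN⟩ : ∃ N, N = s * (m * s + 1) := ⟨_, rfl⟩
  have hcard : q ^ 2 - 1 = 4 * m * N := by
    rw [show q ^ 2 = 4 * m * N + 1 by rw [hqs, hN]; ring]; rfl
  have hmpos : 0 < m := by omega
  have hspos : 0 < s := by omega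
  have hnN : n = (m + 2) * N := by
    rw [hcard] at hn
    refine Nat.eq_of_mul_eq_mul_left (by positivity : 0 < 8 * m) ?_
    linarith
  have hks : k ≤ (m + 1) * s := by
    rw [hqs, Nat.add_sub_cancel] at hk
    refine le_of_mul_le_mul_left ?_ (by positivity : 0 < 4 * m)
    linarith
  subst hnN
  have hNpos : 0 < N := by rw [hN]; positivity
  obtain ⟨φ, hφ⟩ := FiniteField.exists_ringHom_eq_pow hq F hF
  obtain ⟨θ, hθ, -⟩ := FiniteField.exists_orderOf_eq F hF
  rw [hcard] at hθ
  have hordpos : 0 < 4 * m * N := by positivity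
  have hθ0 : θ ≠ 0 := by
    rintro rfl
    rw [orderOf_zero] at hθ
    omega
  have hθinj : ∀ {x y : ℕ}, x < 4 * m * N → y < 4 * m * N → θ ^ x = θ ^ y → x = y :=
    fun hx hy hxy => pow_injOn_Iio_orderOf (by simpa [hθ] using hx) (by simpa [hθ] using hy) hxy
  set g : F := θ ^ ((q + 1) * s) with hg
  have hqN : (q + 1) * s = 2 * N := by rw [hqs, hN]; ring
  set x : Fin (m + 2) → F := fun c => g ^ (c : ℕ) with hx
  have hxinj : Function.Injective x := by
    intro c d hcd
    simp only [hx, hg, ← pow_mul, hqN] at hcd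
    have hlt : ∀ c : Fin (m + 2), 2 * N * (c : ℕ) < 4 * m * N := fun c => by
      have : (c : ℕ) < 2 * m := by omega
      nlinarith
    have := hθinj (hlt c) (hlt d) hcd
    exact Fin.ext (Nat.eq_of_mul_eq_mul_left (by positivity) this)
  have hgq : g ^ q = g := by
    have : g ^ (q - 1) = 1 := by
      rw [hg, ← pow_mul]
      refine orderOf_dvd_iff_pow_eq_one.1 ⟨s, ?_⟩
      rw [hθ, hqN, hqs, Nat.add_sub_cancel]
      ring
    calc g ^ q = g ^ (q - 1) * g := by
          rw [← pow_succ, Nat.sub_add_cancel hq.one_lt.le]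
      _ = g := by rw [this, one_mul]
  have hxq : ∀ c, φ (x c) = x c := fun c => by
    rw [hφ, hx, pow_right_comm, hgq]
  have hx0 : ∀ c, x c ≠ 0 := fun c => pow_ne_zero _ (pow_ne_zero _ hθ0)
  have hz : ∀ c, ∃ z : F, z ≠ 0 ∧
      z ^ (q + 1) = (∏ d ∈ univ.erase c, (x c - x d)) * x c := by
    intro c
    refine FiniteField.exists_pow_succ_eq hq.one_lt F hF
      (mul_ne_zero (prod_ne_zero_iff.2 fun d hd => ?_) (hx0 c)) ?_
    · exact sub_ne_zero.2 (hxinj.ne (ne_of_mem_erase hd).symm)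
    · rw [← hφ]
      simp only [map_mul, map_prod, map_sub, hxq]
  choose z hz0 hzq using hz
  let A : Fin (m + 2) × Fin N → F := fun y => θ ^ ((y.1 : ℕ) + 4 * m * (y.2 : ℕ))
  have hA0 : ∀ y, A y ≠ 0 := fun y => pow_ne_zero _ hθ0
  have hAinj : Function.Injective A := by
    rintro ⟨c, l⟩ ⟨d, r⟩ hcd
    have hlt : ∀ (c : Fin (m + 2)) (l : Fin N), (c : ℕ) + 4 * m * (l : ℕ) < 4 * m * N :=
      fun c l => by
        have h1 : 4 * m * ((l : ℕ) + 1) ≤ 4 * m * N := Nat.mul_le_mul_left _ l.2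
        have h2 := c.2
        rw [mul_add] at h1
        omega
    have h1 := hθinj (hlt c l) (hlt d r) hcd
    have hc : (c : ℕ) < 4 * m := by omega
    have hd : (d : ℕ) < 4 * m := by omega
    have h2 : (c : ℕ) = d := by
      have := congrArg (· % (4 * m)) h1
      simpa [Nat.add_mul_mod_self_left, Nat.mod_eq_of_lt hc, Nat.mod_eq_of_lt hd] using this
    have h3 : (l : ℕ) = r := by
      rw [h2] at h1
      exact Nat.eq_of_mul_eq_mul_left (by omega : 0 < 4 * m) (by omega)
    exact Prod.ext (Fin.ext h2) (Fin.ext h3)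
  let e : Fin ((m + 2) * N) ≃ Fin (m + 2) × Fin N := finProdFinEquiv.symm
  refine ⟨fun l => A (e l), fun l => (z (e l).1)⁻¹ * A (e l) ^ (τ + 1),
    hAinj.comp e.injective,
    fun l => mul_ne_zero (inv_ne_zero (hz0 _)) (pow_ne_zero _ (hA0 _)), ?_⟩
  intro i j hi hj
  rw [e.sum_comp (fun y => ((z y.1)⁻¹ * A y ^ (τ + 1)) ^ (q + 1) * A y ^ (q * i + j)),
    Fintype.sum_prod_type]
  obtain ⟨E, hE⟩ : ∃ E, E = q * i + j + (q + 1) * (τ + 1) := ⟨_, rfl⟩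
  have hterm : ∀ (c : Fin (m + 2)) (l : Fin N),
      ((z c)⁻¹ * A (c, l) ^ (τ + 1)) ^ (q + 1) * A (c, l) ^ (q * i + j) =
        ((z c ^ (q + 1))⁻¹ * θ ^ ((c : ℕ) * E)) * (θ ^ (4 * m * E)) ^ (l : ℕ) := by
    intro c l
    have : ((z c)⁻¹ * A (c, l) ^ (τ + 1)) ^ (q + 1) * A (c, l) ^ (q * i + j) =
        (z c ^ (q + 1))⁻¹ * A (c, l) ^ E := by
      rw [hE]; ring
    rw [this, mul_assoc]
    congr 1
    simp only [A, ← pow_mul, ← pow_add]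
    congr 1
    ring
  simp only [hterm, ← mul_sum]
  by_cases hdvd : N ∣ E
  · rw [hE, hN] at hdvd
    obtain ⟨p, hp, rfl, hip⟩ := exists_eq_mul_of_dvd_exponent hτ hm hs hqs
      (hi.trans_le hks) (hj.trans_le hks) hdvd
    have hEp : E = (q + 1) * s * (p + 1) := by
      rw [hE, mul_assoc, ← hip]; ring
    rw [← sum_mul]
    refine mul_eq_zero_of_left ?_ _
    rw [← sum_pow_div_prod_sub_eq_zero hxinj (p := p) (by simpa using hp)]
    refine sum_congr rfl fun c _ => ?_
    have : θ ^ ((c : ℕ) * E) = x c ^ p * x c := by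
      rw [← pow_succ, hEp]
      simp only [hx, hg, ← pow_mul]
      congr 1
      ring
    rw [hzq, this, mul_inv, div_eq_mul_inv]
    have := hx0 c
    field_simp
  · have hne : θ ^ (4 * m * E) ≠ 1 := fun h1 => hdvd <| by
      have := orderOf_dvd_of_pow_eq_one h1
      rw [hθ] at this
      exact Nat.dvd_of_mul_dvd_mul_left (by positivity) this
    have hone : (θ ^ (4 * m * E)) ^ N = 1 := by
      rw [← pow_mul]
      refine orderOf_dvd_iff_pow_eq_one.1 ⟨E, ?_⟩
      rw [hθ]; ring
    have hsum : ∑ l : Fin N, (θ ^ (4 * m * E)) ^ (l : ℕ) = 0 := by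
      rw [Fin.sum_univ_eq_sum_range (fun l => (θ ^ (4 * m * E)) ^ l), geom_sum_eq hne, hone,
        sub_self, zero_div]
    simp [hsum]
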